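/- For every n and m with 1 ≤ m ≤ n, the number of Schröder paths of semilength n with exactly n−m diagonal steps equals C(m)·binom(n+m, n−m), where C(m) is the m-th Catalan number. -/

import Mathlib

/-! Schröder paths -/

inductive SStep : Type
  | H | V | D
deriving DecidableEq

def SStep.dx : SStep → ℕ
  | .H => 1 | .V => 0 | .D => 1

def SStep.dy : SStep → ℕ
  | .H => 0 | .V => 1 | .D => 1

def pathX (p : List SStep) : ℕ := (p.map SStep.dx).sum
def pathY (p : List SStep) : ℕ := (p.map SStep.dy).sum

/-- A Schröder path of semilength `n`: from (0,0) to (n,n), steps H,V,D,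
never rising above the diagonal. -/
def IsSchroder (n : ℕ) (p : List SStep) : Prop :=
  pathX p = n ∧ pathY p = n ∧ ∀ q : List SStep, q <+: p → pathY q ≤ pathX q

/-- No diagonal step starts on the diagonal. -/
def DiagFree (p : List SStep) : Prop :=
  ∀ q r : List SStep, p = q ++ SStep.D :: r → pathX q ≠ pathY q

/-- Every diagonal step is immediately followed by a horizontal step,
except if it is the last step. -/
def DFollowedByH (p : List SStep) : Prop :=
  ∀ q r : List SStep, p = q ++ SStep.D :: r → r = [] ∨ ∃ r' : List SStep, r = SStep.H :: r'

def SP (n m : ℕ) : Type := {p : List SStep // IsSchroder n p ∧ p.count SStep.D + m = n}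
def SPplus (n m : ℕ) : Type :=
  {p : List SStep // IsSchroder n p ∧ p.count SStep.D + m = n ∧ DiagFree p}
def SPzero (n m : ℕ) : Type :=
  {p : List SStep // IsSchroder n p ∧ p.count SStep.D + m = n ∧ ¬ DiagFree p}
def RP (n m : ℕ) : Type :=
  {p : List SStep // IsSchroder n p ∧ p.count SStep.D + m = n ∧ DFollowedByH p}

/-! Rooted planar trees -/

inductive PTree : Type
  | node : List PTree → PTree

namespace PTree

def leaves : PTree → ℕ
  | node [] => 1
  | node (c :: cs) => ((c :: cs).attach.map fun x => leaves x.1).sum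
decreasing_by
  have := List.sizeOf_lt_of_mem x.2
  simp only [PTree.node.sizeOf_spec, List.cons.sizeOf_spec] at this ⊢
  omega

def internal : PTree → ℕ
  | node [] => 0
  | node (c :: cs) => 1 + ((c :: cs).attach.map fun x => internal x.1).sum
decreasing_by
  have := List.sizeOf_lt_of_mem x.2
  simp only [PTree.node.sizeOf_spec, List.cons.sizeOf_spec] at this ⊢
  omega

def Good : PTree → Prop
  | node cs => cs.length ≠ 1 ∧ ∀ c ∈ cs.attach, Good c.1
decreasing_by
  have := List.sizeOf_lt_of_mem c.2
  simp only [PTree.node.sizeOf_spec] at this ⊢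
  omega

end PTree

def PT (n m : ℕ) : Type :=
  {t : PTree // t.Good ∧ t.leaves = n + 1 ∧ t.internal = m}

def PTn (n : ℕ) : Type := {t : PTree // t.Good ∧ t.leaves = n + 1}

/-! Motzkin paths -/

inductive MStep : Type
  | U | H | D
deriving DecidableEq

def MStep.dh : MStep → ℤ
  | .U => 1 | .H => 0 | .D => -1

def mHeight (p : List MStep) : ℤ := (p.map MStep.dh).sum

def IsMotzkin (k : ℕ) (p : List MStep) : Prop :=
  p.length = k ∧ mHeight p = 0 ∧ ∀ q : List MStep, q <+: p → 0 ≤ mHeight q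

def HFollowedByU (p : List MStep) : Prop :=
  ∀ q r : List MStep, p = q ++ MStep.H :: r → r = [] ∨ ∃ r' : List MStep, r = MStep.U :: r'

def MP (k : ℕ) : Type := {p : List MStep // IsMotzkin k p}
def RMP (k : ℕ) : Type := {p : List MStep // IsMotzkin k p ∧ HFollowedByU p}

/-- Motzkin steps with two possible colors on up and horizontal steps. -/
inductive CMStep : Type
  | U : Bool → CMStep
  | H : Bool → CMStep
  | D : CMStep
deriving DecidableEq

def CMStep.forget : CMStep → MStep
  | .U _ => .U | .H _ => .H | .D => .D

/-- (h,u)-colored Motzkin paths of length n-1. -/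
def huMP (n : ℕ) : Type := {p : List CMStep // IsMotzkin (n - 1) (p.map CMStep.forget)}

/-- The number of paths with `b` up steps and `b + h` down steps that start at height `h` and never
go below height `0`. -/
def ballotCount : ℕ → ℕ → ℕ
  | 0, _ => 1
  | b + 1, 0 => ballotCount b 1
  | b + 1, h + 1 => ballotCount (b + 1) h + ballotCount b (h + 2)

open Nat in
theorem ballotCount_mul_factorial (b h : ℕ) :
    ballotCount b h * (b ! * (b + h + 1)!) = (h + 1) * (2 * b + h)! := by
  induction b, h using ballotCount.induct with
  | case1 h => simp [ballotCount, Nat.factorial_succ]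
  | case2 b ih =>
    simp only [ballotCount, show 2 * (b + 1) + 0 = 2 * b + 1 + 1 by ring,
      show b + 1 + 0 + 1 = b + 1 + 1 by ring, Nat.factorial_succ (2 * b + 1),
      Nat.factorial_succ b] at ih ⊢
    linear_combination (b + 1) * ih
  | case3 b h ih₁ ih₂ =>
    simp only [ballotCount, Nat.succ_eq_add_one,
      show 2 * (b + 1) + (h + 1) = 2 * b + h + 2 + 1 by ring,
      show 2 * (b + 1) + h = 2 * b + h + 2 by ring,
      show 2 * b + (h + 2) = 2 * b + h + 2 by ring,
      show b + 1 + (h + 1) + 1 = b + h + 2 + 1 by ring,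
      show b + 1 + h + 1 = b + h + 2 by ring,
      show b + (h + 2) + 1 = b + h + 2 + 1 by ring, Nat.factorial_succ (2 * b + h + 2),
      Nat.factorial_succ (b + h + 2), Nat.factorial_succ b] at ih₁ ih₂ ⊢
    linear_combination (b + h + 3) * ih₁ + (b + 1) * ih₂

open Nat in
theorem ballotCount_zero_right (m : ℕ) : ballotCount m 0 = catalan m := by
  have h₁ := ballotCount_mul_factorial m 0
  have h₂ := succ_mul_catalan_eq_centralBinom m
  have h₃ := Nat.choose_mul_factorial_mul_factorial (show m ≤ 2 * m by omega)
  rw [show 2 * m - m = m by omega, ← Nat.centralBinom_eq_two_mul_choose, ← h₂] at h₃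
  simp only [add_zero, zero_add, one_mul, Nat.factorial_succ] at h₁
  have hpos : 0 < m ! * ((m + 1) * m !) := by positivity
  apply Nat.eq_of_mul_eq_mul_right hpos
  linear_combination h₁ - h₃

/-- Schröder paths started at height `h` above the lower boundary, with `b` horizontal and
`d` diagonal steps. -/
def schroderFrom (b h d : ℕ) : Set (List SStep) :=
  {p | p.count SStep.H = b ∧ p.count SStep.D = d ∧ pathY p = pathX p + h ∧
    ∀ q : List SStep, q <+: p → pathY q ≤ pathX q + h}

@[simp]
theorem pathX_nil : pathX [] = 0 := rfl

@[simp]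
theorem pathY_nil : pathY [] = 0 := rfl

@[simp]
theorem pathX_cons (s : SStep) (p : List SStep) : pathX (s :: p) = s.dx + pathX p := by
  simp [pathX]

@[simp]
theorem pathY_cons (s : SStep) (p : List SStep) : pathY (s :: p) = s.dy + pathY p := by
  simp [pathY]

theorem pathX_eq_count (p : List SStep) : pathX p = p.count SStep.H + p.count SStep.D := by
  induction p with
  | nil => rfl
  | cons s p ih => cases s <;> simp [SStep.dx, ih] <;> omega

theorem forall_prefix_cons {α : Type*} {P : List α → Prop} {s : α} {p : List α} :
    (∀ q, q <+: s :: p → P q) ↔ P [] ∧ ∀ q, q <+: p → P (s :: q) := by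
  constructor
  · exact fun h => ⟨h _ List.nil_prefix, fun q hq => h _ (by simpa using hq)⟩
  · rintro ⟨h₀, h₁⟩ q hq
    rcases List.prefix_cons_iff.1 hq with rfl | ⟨t, rfl, ht⟩
    exacts [h₀, h₁ t ht]

theorem cons_V_preimage_succ (b h d : ℕ) :
    List.cons SStep.V ⁻¹' schroderFrom b (h + 1) d = schroderFrom b h d := by
  ext p
  simp only [schroderFrom, Set.mem_preimage, Set.mem_ofPred_eq, forall_prefix_cons]
  simp [SStep.dx, SStep.dy, add_comm 1, ← add_assoc]

theorem cons_V_preimage_zero (b d : ℕ) :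
    List.cons SStep.V ⁻¹' schroderFrom b 0 d = ∅ := by
  ext p
  simp only [schroderFrom, Set.mem_preimage, Set.mem_ofPred_eq, forall_prefix_cons]
  simp only [Set.mem_empty_iff_false, iff_false]
  rintro ⟨-, -, -, -, h⟩
  simpa [SStep.dx, SStep.dy] using h [] List.nil_prefix

theorem cons_H_preimage_succ (b h d : ℕ) :
    List.cons SStep.H ⁻¹' schroderFrom (b + 1) h d = schroderFrom b (h + 1) d := by
  ext p
  simp only [schroderFrom, Set.mem_preimage, Set.mem_ofPred_eq, forall_prefix_cons]
  simp [SStep.dx, SStep.dy, add_comm 1, add_assoc]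

theorem cons_H_preimage_zero (h d : ℕ) :
    List.cons SStep.H ⁻¹' schroderFrom 0 h d = ∅ := by
  ext p
  simp [schroderFrom]

theorem cons_D_preimage_succ (b h d : ℕ) :
    List.cons SStep.D ⁻¹' schroderFrom b h (d + 1) = schroderFrom b h d := by
  ext p
  simp only [schroderFrom, Set.mem_preimage, Set.mem_ofPred_eq, forall_prefix_cons]
  simp [SStep.dx, SStep.dy, add_assoc]

theorem cons_D_preimage_zero (b h : ℕ) :
    List.cons SStep.D ⁻¹' schroderFrom b h 0 = ∅ := by
  ext p
  simp [schroderFrom]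

theorem nil_mem_schroderFrom {b h d : ℕ} :
    [] ∈ schroderFrom b h d ↔ b = 0 ∧ h = 0 ∧ d = 0 := by
  simp [schroderFrom]
  omega

theorem schroderFrom_zero : schroderFrom 0 0 0 = {[]} := by
  ext p
  cases p with
  | nil => simp [nil_mem_schroderFrom]
  | cons s p =>
    have hV : p ∉ List.cons SStep.V ⁻¹' schroderFrom 0 0 0 := by simp [cons_V_preimage_zero]
    cases s
    · simp [schroderFrom]
    · simpa using hV
    · simp [schroderFrom]

theorem encard_eq_encard_preimage_cons {A : Set (List SStep)} (hA : [] ∉ A) :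
    A.encard = (List.cons SStep.H ⁻¹' A).encard + (List.cons SStep.V ⁻¹' A).encard +
      (List.cons SStep.D ⁻¹' A).encard := by
  have hinj (s : SStep) : Function.Injective (List.cons s) := List.cons_injective
  have hunion : A = List.cons SStep.H '' (List.cons SStep.H ⁻¹' A) ∪
      List.cons SStep.V '' (List.cons SStep.V ⁻¹' A) ∪
      List.cons SStep.D '' (List.cons SStep.D ⁻¹' A) := by
    ext p
    rcases p with _ | ⟨_ | _ | _, p⟩ <;> simp [hA]
  conv_lhs => rw [hunion]
  rw [Set.encard_union_eq, Set.encard_union_eq, (hinj .H).encard_image, (hinj .V).encard_image,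
    (hinj .D).encard_image]
  · rw [Set.disjoint_left]
    rintro p ⟨_, -, rfl⟩
    simp
  · rw [Set.disjoint_left]
    rintro p (⟨_, -, rfl⟩ | ⟨_, -, rfl⟩) <;> simp

theorem encard_schroderFrom (b h d : ℕ) :
    (schroderFrom b h d).encard = (ballotCount b h * (2 * b + h + d).choose d : ℕ) := by
  induction hk : 2 * b + h + d generalizing b h d with
  | zero =>
    obtain ⟨rfl, rfl, rfl⟩ : b = 0 ∧ h = 0 ∧ d = 0 := by omega
    simp [schroderFrom_zero, ballotCount]
  | succ k ih =>
    rw [encard_eq_encard_preimage_cons (by rw [nil_mem_schroderFrom]; omega)]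
    rcases b with _ | b <;> rcases h with _ | h <;> rcases d with _ | d <;>
      simp only [cons_V_preimage_succ, cons_V_preimage_zero, cons_H_preimage_succ,
        cons_H_preimage_zero, cons_D_preimage_succ, cons_D_preimage_zero, Set.encard_empty]
    all_goals
      repeat rw [ih _ _ _ (by omega)]
    all_goals
      norm_cast
      try simp only [ballotCount, Nat.choose_zero_right, Nat.choose_succ_succ]
      try ring1
    · omega
    · obtain rfl : k = d := by omega
      simp

/-- for 1 ≤ m ≤ n, |SP(n,m)| = C(m)·binom(n+m, n−m). -/
theorem statement5 (n m : ℕ) (hm : 1 ≤ m) (hmn : m ≤ n) :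
    Nat.card (SP n m) = catalan m * (n + m).choose (n - m) := by
  have hset : {p | IsSchroder n p ∧ p.count SStep.D + m = n} = schroderFrom m 0 (n - m) := by
    ext p
    have := pathX_eq_count p
    simp only [IsSchroder, schroderFrom, Set.mem_ofPred_eq, add_zero]
    constructor
    · rintro ⟨⟨hx, hy, hp⟩, hd⟩
      exact ⟨by omega, by omega, by omega, hp⟩
    · rintro ⟨hh, hd, hy, hp⟩
      exact ⟨⟨by omega, by omega, hp⟩, by omega⟩
  change Nat.card ↥{p | IsSchroder n p ∧ p.count SStep.D + m = n} = _
  rw [hset, Nat.card_coe_set_eq, Set.ncard, encard_schroderFrom, ENat.toNat_natCast,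
    ballotCount_zero_right]
  congr 2
  omega
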